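/- Let N ≥ 1 and let (Γ_a)_{a=0}^{10} be real N×N matrices satisfying the 11d Clifford relations (with 1 = the identity matrix). Then for every p with 1 ≤ p ≤ 10 and every tuple (a₁,…,a_p) of indices in {0,…,10}, the trace of the antisymmetrized Clifford element vanishes: Tr(Γ_{a₁⋯a_p}) = 0. -/

import Mathlib

open Matrix BigOperators

noncomputable section

/-- The 11×11 Minkowski metric `η = diag(−1,+1,…,+1)`. -/
def eta (a b : Fin 11) : ℝ :=
  if a = b then (if a = 0 then -1 else 1) else 0

/-- The 11d Clifford relations `Γ_a Γ_b + Γ_b Γ_a = 2 η_{ab} · 1`. -/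
def CliffordRel {A : Type*} [Ring A] [Algebra ℝ A] (Γ : Fin 11 → A) : Prop :=
  ∀ a b : Fin 11, Γ a * Γ b + Γ b * Γ a = (2 * eta a b) • (1 : A)

/-- The antisymmetrized Clifford element
`Γ_{a₁⋯a_p} = (1/p!) Σ_{σ ∈ S_p} sgn(σ) Γ_{a_{σ(1)}} ⋯ Γ_{a_{σ(p)}}`. -/
def gammaA {A : Type*} [Ring A] [Algebra ℝ A] (Γ : Fin 11 → A) (p : ℕ)
    (a : Fin p → Fin 11) : A :=
  (p.factorial : ℝ)⁻¹ • ∑ σ : Equiv.Perm (Fin p),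
    ((Equiv.Perm.sign σ : ℤ) : ℝ) • (List.ofFn fun i => Γ (a (σ i))).prod

/-- The Levi-Civita symbol (lower indices): the sign of `(a₁,…,a₁₁)` as a permutation
of `(0,…,10)`, and `0` if two indices coincide; in particular `ε_{0 1 ⋯ 10} = +1`. -/
def epsL (a : Fin 11 → Fin 11) : ℝ :=
  ∑ σ : Equiv.Perm (Fin 11),
    if (∀ i, a i = σ i) then ((Equiv.Perm.sign σ : ℤ) : ℝ) else 0
section CliffordTrace

variable {A : Type*} [Ring A] [Algebra ℝ A] {Γ : Fin 11 → A}

lemma CliffordRel.anticomm (hC : CliffordRel Γ) {c d : Fin 11} (h : c ≠ d) :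
    Γ c * Γ d = -(Γ d * Γ c) := by
  have := hC c d
  rw [eta, if_neg h, mul_zero, zero_smul] at this
  exact eq_neg_of_add_eq_zero_left this

lemma CliffordRel.sq (hC : CliffordRel Γ) (c : Fin 11) :
    Γ c * Γ c = eta c c • (1 : A) := by
  have h := hC c c
  rw [← two_smul ℝ, mul_smul] at h
  exact smul_right_injective A (two_ne_zero : (2 : ℝ) ≠ 0) h

lemma eta_self_ne_zero (c : Fin 11) : eta c c ≠ 0 := by
  unfold eta
  split_ifs <;> simp_all

/-- Commuting a generator past a word costs one sign for each letter different from it. -/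
lemma CliffordRel.mul_prod (hC : CliffordRel Γ) (c : Fin 11) (l : List (Fin 11)) :
    Γ c * (l.map Γ).prod = (-1) ^ (l.length + l.count c) * ((l.map Γ).prod * Γ c) := by
  induction l with
  | nil => simp
  | cons d l ih =>
    have hcomm := ((Commute.neg_one_left (Γ d)).pow_left (l.length + l.count c)).eq
    rw [List.map_cons, List.prod_cons, ← mul_assoc]
    by_cases h : c = d
    · subst h
      rw [List.length_cons, List.count_cons_self,
        show l.length + 1 + (l.count c + 1) = l.length + l.count c + 2 by ring,
        pow_add _ _ 2, neg_one_sq, mul_one]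
      conv_lhs => rw [mul_assoc, ih, ← mul_assoc, ← hcomm]
      simp only [mul_assoc]
    · rw [hC.anticomm h, neg_mul, mul_assoc, ih, ← mul_assoc, ← hcomm, List.length_cons,
        List.count_cons_of_ne (Ne.symm h),
        show l.length + 1 + l.count c = l.length + l.count c + 1 by ring, pow_succ]
      simp [mul_assoc]

/-- The antisymmetrized element vanishes when an index is repeated. -/
lemma gammaA_eq_zero_of_not_injective (Γ : Fin 11 → A) {p : ℕ} {a : Fin p → Fin 11}
    (ha : ¬ Function.Injective a) : gammaA Γ p a = 0 := by
  obtain ⟨i, j, hij, hne⟩ := Function.not_injective_iff.mp ha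
  have hswap : ∀ k, a (Equiv.swap i j k) = a k := by
    intro k
    rw [Equiv.swap_apply_def]
    split_ifs <;> simp_all
  unfold gammaA
  rw [Finset.sum_involution (fun σ _ => Equiv.swap i j * σ), smul_zero]
  · intro σ _
    simp [Equiv.Perm.sign_mul, Equiv.Perm.sign_swap hne, hswap]
  · intro σ _ _ h
    exact hne (Equiv.swap_eq_one_iff.mp (mul_eq_right.mp h))
  · simp
  · intro σ _
    simp [← mul_assoc]

end CliffordTrace

lemma CliffordRel.trace_eq_zero_of_anticomm {n : Type*} [Fintype n] [DecidableEq n]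
    {Γ : Fin 11 → Matrix n n ℝ} (hC : CliffordRel Γ) {P : Matrix n n ℝ} (c : Fin 11)
    (h : Γ c * P = -(P * Γ c)) : P.trace = 0 := by
  have h1 : (Γ c * P * Γ c).trace = eta c c * P.trace := by
    rw [Matrix.trace_mul_comm, ← mul_assoc, hC.sq]
    simp
  have h2 : (Γ c * P * Γ c).trace = -(eta c c * P.trace) := by
    rw [h, neg_mul, mul_assoc, hC.sq]
    simp
  have h3 : eta c c * P.trace = 0 := by linarith
  exact (mul_eq_zero.mp h3).resolve_left (eta_self_ne_zero c)

lemma CliffordRel.trace_prod_eq_zero {n : Type*} [Fintype n] [DecidableEq n]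
    {Γ : Fin 11 → Matrix n n ℝ} (hC : CliffordRel Γ) {l : List (Fin 11)} (hl : l.Nodup)
    (h1 : 1 ≤ l.length) (h10 : l.length ≤ 10) : (l.map Γ).prod.trace = 0 := by
  obtain ⟨c, hc⟩ : ∃ c, Odd (l.length + l.count c) := by
    rcases Nat.even_or_odd l.length with he | ho
    · obtain ⟨c, hc⟩ := List.exists_mem_of_length_pos h1
      exact ⟨c, by rw [List.count_eq_one_of_mem hl hc]; exact he.add_one⟩
    · obtain ⟨c, hc⟩ : ∃ c, c ∉ l.toFinset := by
        by_contra! hall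
        have hcard := List.toFinset_card_le l
        rw [Finset.eq_univ_iff_forall.mpr hall, Finset.card_univ, Fintype.card_fin] at hcard
        omega
      exact ⟨c, by rwa [List.count_eq_zero_of_not_mem (by simpa using hc), add_zero]⟩
  refine hC.trace_eq_zero_of_anticomm c ?_
  rw [hC.mul_prod, hc.neg_one_pow, neg_one_mul]

/-- For real N×N Clifford generator matrices (N ≥ 1) and `1 ≤ p ≤ 10`, the trace of the
antisymmetrized Clifford element vanishes: `Tr(Γ_{a₁⋯a_p}) = 0`. -/
theorem trace_gammaA_eq_zero (N : ℕ) (hN : 1 ≤ N)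
    (Γ : Fin 11 → Matrix (Fin N) (Fin N) ℝ) (hC : CliffordRel Γ)
    (p : ℕ) (hp1 : 1 ≤ p) (hp : p ≤ 10) (a : Fin p → Fin 11) :
    (gammaA Γ p a).trace = 0 := by
  by_cases ha : Function.Injective a
  · unfold gammaA
    rw [Matrix.trace_smul, Matrix.trace_sum, Finset.sum_eq_zero, smul_zero]
    intro σ _
    have hprod : (List.ofFn fun i => Γ (a (σ i))) = (List.ofFn fun i => a (σ i)).map Γ := by
      rw [List.map_ofFn]
      rfl
    rw [Matrix.trace_smul, hprod, hC.trace_prod_eq_zero, smul_zero]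
    · exact List.nodup_ofFn.mpr (ha.comp σ.injective)
    · simpa using hp1
    · simpa using hp
  · rw [gammaA_eq_zero_of_not_injective Γ ha, Matrix.trace_zero]

end
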